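/- Let s_n = r_0 + r_1 + … + r_{n−1} for n ≥ 1, and for j ∈ ℤ \ {0} let τ_j = inf{n ≥ 1 : s_n = j} (with τ_j = ∞ if no such n exists, and (1/2)^∞ interpreted as 0). Then the minimum value of f over [0,1] is m(f) = −Σ_{k=1}^∞ (1/2)^{τ_{1−2k}}. -/

import Mathlib

/-- `phi x` is the distance from `x` to the nearest integer. -/
noncomputable def phi (x : ℝ) : ℝ := |x - round x|

/-- The signed Takagi function associated to the sign sequence `r`. -/
noncomputable def takagi (r : ℕ → ℝ) (x : ℝ) : ℝ :=
  ∑' n : ℕ, r n / 2 ^ n * phi (2 ^ n * x)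

/-- `tau r j` is the first time `n ≥ 1` at which the partial sum
`s_n = r_0 + ⋯ + r_{n-1}` equals `j` (and `⊤` if there is no such time). -/
noncomputable def tau (r : ℕ → ℝ) (j : ℤ) : ℕ∞ :=
  sInf {t : ℕ∞ | ∃ n : ℕ, (n : ℕ∞) = t ∧ 1 ≤ n ∧ (∑ i ∈ Finset.range n, r i) = (j : ℝ)}

/-- `(1/2)^t` for `t ∈ ℕ∞`, with the convention `(1/2)^∞ = 0`. -/
noncomputable def halfPow (t : ℕ∞) : ℝ :=
  WithTop.recTopCoe 0 (fun n : ℕ => (1 / 2 : ℝ) ^ n) t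

lemma phi_eq_norm (x : ℝ) : phi x = ‖(x : UnitAddCircle)‖ :=
  UnitAddCircle.norm_eq.symm

lemma phi_nonneg (x : ℝ) : 0 ≤ phi x := abs_nonneg _

lemma phi_le_half (x : ℝ) : phi x ≤ 1 / 2 := abs_sub_round x

lemma continuous_phi : Continuous phi := by
  have h : phi = fun x : ℝ => ‖(x : UnitAddCircle)‖ := funext phi_eq_norm
  rw [h]
  exact continuous_norm.comp (AddCircle.continuous_mk' 1)

lemma phi_natCast_sub (m : ℕ) (x : ℝ) : phi (m - x) = phi x := by
  have h : ((m : ℝ) : UnitAddCircle) = 0 :=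
    (AddCircle.coe_eq_zero_iff 1).2 ⟨m, by simp⟩
  rw [phi_eq_norm, phi_eq_norm, AddCircle.coe_sub, h, zero_sub, norm_neg]

lemma phi_eq_self {x : ℝ} (h0 : 0 ≤ x) (h1 : x ≤ 1 / 2) : phi x = x := by
  rw [phi, abs_sub_round_eq_min, Int.fract_eq_self.2 ⟨h0, by linarith⟩]
  exact min_eq_left (by linarith)

lemma norm_takagi_term_le {r : ℕ → ℝ} (hr : ∀ n, r n = 1 ∨ r n = -1) (n : ℕ) (x : ℝ) :
    ‖r n / 2 ^ n * phi (2 ^ n * x)‖ ≤ 1 / 2 / 2 ^ n := by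
  have hrn : |r n| = 1 := by rcases hr n with h | h <;> simp [h]
  rw [Real.norm_eq_abs, abs_mul, abs_div, hrn, abs_of_nonneg (phi_nonneg _),
    abs_of_pos (by positivity : (0 : ℝ) < 2 ^ n)]
  calc 1 / 2 ^ n * phi (2 ^ n * x) ≤ 1 / 2 ^ n * (1 / 2) := by gcongr; exact phi_le_half _
    _ = 1 / 2 / 2 ^ n := by ring

lemma summable_takagi {r : ℕ → ℝ} (hr : ∀ n, r n = 1 ∨ r n = -1) (x : ℝ) :
    Summable fun n : ℕ => r n / 2 ^ n * phi (2 ^ n * x) :=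
  .of_norm_bounded (summable_geometric_two' 1) fun n => norm_takagi_term_le hr n x

lemma continuous_takagi {r : ℕ → ℝ} (hr : ∀ n, r n = 1 ∨ r n = -1) :
    Continuous (takagi r) :=
  continuous_tsum (fun _ => continuous_const.mul (continuous_phi.comp (continuous_const_mul _)))
    (summable_geometric_two' 1) fun n x => norm_takagi_term_le hr n x

lemma neg_one_le_takagi {r : ℕ → ℝ} (hr : ∀ n, r n = 1 ∨ r n = -1) (x : ℝ) :
    -1 ≤ takagi r x :=
  (abs_le.1 (tsum_of_norm_bounded (hasSum_geometric_two' 1)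
    fun n => norm_takagi_term_le hr n x)).1

lemma takagi_one_sub (r : ℕ → ℝ) (x : ℝ) : takagi r (1 - x) = takagi r x := by
  refine tsum_congr fun n => ?_
  have h : (2 : ℝ) ^ n * (1 - x) = (2 ^ n : ℕ) - 2 ^ n * x := by push_cast; ring
  rw [h, phi_natCast_sub]

lemma takagi_zero (r : ℕ → ℝ) : takagi r 0 = 0 := by
  simp [takagi, phi]

/-- Self-similarity of the signed Takagi function on the left half of the unit interval. -/
lemma takagi_half {r : ℕ → ℝ} (hr : ∀ n, r n = 1 ∨ r n = -1) {y : ℝ} (hy : y ∈ Set.Icc 0 1) :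
    takagi r (y / 2) = (r 0 * y + takagi (fun n => r (n + 1)) y) / 2 := by
  obtain ⟨h0, h1⟩ := hy
  have hphi : phi (y / 2) = y / 2 := phi_eq_self (by linarith) (by linarith)
  have hshift : ∑' n : ℕ, r (n + 1) / 2 ^ (n + 1) * phi (2 ^ (n + 1) * (y / 2))
      = takagi (fun n => r (n + 1)) y / 2 := by
    rw [takagi, ← tsum_div_const]
    refine tsum_congr fun n => ?_
    have h : (2 : ℝ) ^ (n + 1) * (y / 2) = 2 ^ n * y := by ring
    rw [h]
    ring
  rw [takagi, (summable_takagi hr _).tsum_eq_zero_add, hshift, pow_zero, one_mul, div_one, hphi]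
  ring

@[simp] lemma halfPow_top : halfPow ⊤ = 0 := rfl

@[simp] lemma halfPow_natCast (n : ℕ) : halfPow n = (1 / 2) ^ n := rfl

lemma halfPow_nonneg (t : ℕ∞) : 0 ≤ halfPow t := by
  induction t with
  | top => simp
  | coe n => rw [halfPow_natCast]; positivity

lemma halfPow_add_one (t : ℕ∞) : halfPow (t + 1) = halfPow t / 2 := by
  induction t with
  | top => simp
  | coe n =>
    have h : (n : ℕ∞) + 1 = (n + 1 : ℕ) := by simp
    rw [h, halfPow_natCast, halfPow_natCast]
    ring

lemma halfPow_le {n : ℕ} {t : ℕ∞} (h : n ≤ t) : halfPow t ≤ (1 / 2) ^ n := by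
  induction t with
  | top => rw [halfPow_top]; positivity
  | coe m =>
    exact pow_le_pow_of_le_one (by norm_num) (by norm_num) (by exact_mod_cast h)

lemma neg_le_sum_range {r : ℕ → ℝ} (hr : ∀ n, r n = 1 ∨ r n = -1) (n : ℕ) :
    -(n : ℝ) ≤ ∑ i ∈ Finset.range n, r i := by
  induction n with
  | zero => simp
  | succ n ih =>
    rw [Finset.sum_range_succ]
    push_cast
    rcases hr n with h | h <;> rw [h] <;> linarith

lemma le_tau_neg {r : ℕ → ℝ} (hr : ∀ n, r n = 1 ∨ r n = -1) (m : ℕ) :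
    (m : ℕ∞) ≤ tau r (-(m : ℤ)) := by
  refine le_sInf ?_
  rintro _ ⟨n, rfl, -, hn⟩
  have h := neg_le_sum_range hr n
  rw [hn] at h
  push_cast at h
  have : (m : ℝ) ≤ n := by linarith
  exact_mod_cast this

lemma tau_eq_one {r : ℕ → ℝ} {j : ℤ} (h : r 0 = j) : tau r j = 1 := by
  refine le_antisymm (sInf_le ⟨1, by simp, le_rfl, by simpa using h⟩) (le_sInf ?_)
  rintro _ ⟨n, rfl, hn, -⟩
  exact_mod_cast hn

lemma tau_eq_tau_shift {r : ℕ → ℝ} {i j e : ℤ} (he : r 0 = e) (hj : j ≠ e) (hi : i + e = j) :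
    tau r j = tau (fun n => r (n + 1)) i + 1 := by
  have hij : (j : ℝ) = i + e := by rw [← hi]; push_cast; rfl
  refine le_antisymm ?_ (le_sInf ?_)
  · rcases Set.eq_empty_or_nonempty {t : ℕ∞ | ∃ n : ℕ, (n : ℕ∞) = t ∧ 1 ≤ n ∧
        (∑ k ∈ Finset.range n, r (k + 1)) = (i : ℝ)} with h | h
    · rw [show tau (fun n => r (n + 1)) i = ⊤ by rw [tau, h, sInf_empty]]
      simp
    · obtain ⟨n, hn, -, hsum⟩ := csInf_mem h
      change (n : ℕ∞) = tau (fun n => r (n + 1)) i at hn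
      rw [← hn]
      exact sInf_le ⟨n + 1, by simp, by simp, by rw [Finset.sum_range_succ', hsum, he, hij]⟩
  · rintro _ ⟨n, rfl, hn, hsum⟩
    obtain ⟨m, rfl⟩ := Nat.exists_eq_add_of_le' hn
    rw [Finset.sum_range_succ', he, hij, add_left_inj] at hsum
    rcases Nat.eq_zero_or_pos m with rfl | hm
    · have hi0 : i = 0 := by
        have : (i : ℝ) = 0 := by simpa using hsum.symm
        exact_mod_cast this
      omega
    · push_cast
      gcongr
      exact sInf_le ⟨m, rfl, hm, hsum⟩

/-- The sum of `(1/2)^τ` over the first passage times `τ` of the walk started at height `j` to the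
levels `-1, -3, -5, …`. -/
noncomputable def passageSum (r : ℕ → ℝ) (j : ℕ) : ℝ :=
  ∑' k : ℕ, halfPow (tau r (-(2 * (k : ℤ) + 1 + j)))

lemma halfPow_tau_le {r : ℕ → ℝ} (hr : ∀ n, r n = 1 ∨ r n = -1) (j k : ℕ) :
    halfPow (tau r (-(2 * (k : ℤ) + 1 + j))) ≤ 1 / 2 / 2 ^ k := by
  have h := le_tau_neg hr (2 * k + 1 + j)
  push_cast at h
  calc halfPow (tau r (-(2 * (k : ℤ) + 1 + j))) ≤ (1 / 2) ^ (2 * k + 1 + j) :=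
        halfPow_le (by push_cast; exact h)
    _ ≤ (1 / 2) ^ (k + 1) := pow_le_pow_of_le_one (by norm_num) (by norm_num) (by omega)
    _ = 1 / 2 / 2 ^ k := by rw [pow_succ, one_div_pow]; ring

lemma summable_passageSum {r : ℕ → ℝ} (hr : ∀ n, r n = 1 ∨ r n = -1) (j : ℕ) :
    Summable fun k : ℕ => halfPow (tau r (-(2 * (k : ℤ) + 1 + j))) :=
  .of_nonneg_of_le (fun _ => halfPow_nonneg _) (halfPow_tau_le hr j) (summable_geometric_two' 1)

lemma passageSum_nonneg (r : ℕ → ℝ) (j : ℕ) : 0 ≤ passageSum r j :=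
  tsum_nonneg fun _ => halfPow_nonneg _

lemma passageSum_le_one {r : ℕ → ℝ} (hr : ∀ n, r n = 1 ∨ r n = -1) (j : ℕ) :
    passageSum r j ≤ 1 :=
  ((summable_passageSum hr j).tsum_le_tsum (halfPow_tau_le hr j)
    (summable_geometric_two' 1)).trans_eq (tsum_geometric_two' 1)

lemma passageSum_of_up {r : ℕ → ℝ} (h : r 0 = 1) (j : ℕ) :
    passageSum r j = passageSum (fun n => r (n + 1)) (j + 1) / 2 := by
  rw [passageSum, passageSum, ← tsum_div_const]
  refine tsum_congr fun k => ?_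
  rw [← halfPow_add_one, tau_eq_tau_shift (e := 1) (by simpa using h) (by omega)]
  push_cast
  ring

lemma passageSum_succ_of_down {r : ℕ → ℝ} (h : r 0 = -1) (j : ℕ) :
    passageSum r (j + 1) = passageSum (fun n => r (n + 1)) j / 2 := by
  rw [passageSum, passageSum, ← tsum_div_const]
  refine tsum_congr fun k => ?_
  rw [← halfPow_add_one, tau_eq_tau_shift (e := -1) (by simpa using h) (by omega)]
  push_cast
  ring

lemma passageSum_zero_of_down {r : ℕ → ℝ} (hr : ∀ n, r n = 1 ∨ r n = -1) (h : r 0 = -1) :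
    passageSum r 0 = (1 + passageSum (fun n => r (n + 1)) 1) / 2 := by
  have h1 : halfPow 1 = 1 / 2 := by simpa using halfPow_natCast 1
  rw [passageSum, (summable_passageSum hr 0).tsum_eq_zero_add,
    tau_eq_one (by simpa using h), h1, add_div, passageSum, ← tsum_div_const]
  congr 1
  refine tsum_congr fun k => ?_
  rw [← halfPow_add_one, tau_eq_tau_shift (e := -1) (by simpa using h) (by omega)]
  push_cast
  ring

lemma neg_passageSum_sub_le_takagi (n : ℕ) {r : ℕ → ℝ} (hr : ∀ n, r n = 1 ∨ r n = -1) (j : ℕ)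
    {x : ℝ} (hx : x ∈ Set.Icc 0 1) : -passageSum r j - (1 / 2) ^ n ≤ j * x + takagi r x := by
  induction n generalizing r j x with
  | zero =>
    have h1 := neg_one_le_takagi hr x
    have h2 := passageSum_nonneg r j
    have h3 : 0 ≤ j * x := mul_nonneg (by positivity) hx.1
    rw [pow_zero]
    linarith
  | succ n ih =>
    wlog hx2 : x ≤ 1 / 2 generalizing x
    · have h := this (x := 1 - x) ⟨by linarith [hx.2], by linarith [hx.1]⟩ (by linarith)
      rw [takagi_one_sub] at h
      have : (j : ℝ) * (1 - x) ≤ j * x := by gcongr; linarith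
      linarith
    obtain ⟨y, rfl⟩ : ∃ y, x = y / 2 := ⟨2 * x, by ring⟩
    have hy : y ∈ Set.Icc (0 : ℝ) 1 := ⟨by linarith [hx.1], by linarith⟩
    have hr' : ∀ n, r (n + 1) = 1 ∨ r (n + 1) = -1 := fun n => hr (n + 1)
    rw [takagi_half hr hy, pow_succ]
    rcases hr 0 with h0 | h0
    · have h := ih hr' (j + 1) hy
      push_cast at h
      rw [passageSum_of_up h0, h0]
      linarith
    · cases j with
      | zero =>
        have h := ih hr' 1 (x := 1 - y) ⟨by linarith [hy.2], by linarith [hy.1]⟩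
        rw [takagi_one_sub] at h
        rw [passageSum_zero_of_down hr h0, h0]
        push_cast at h ⊢
        linarith
      | succ j =>
        have h := ih hr' j hy
        rw [passageSum_succ_of_down h0, h0]
        push_cast
        linarith

lemma exists_takagi_le (n : ℕ) {r : ℕ → ℝ} (hr : ∀ n, r n = 1 ∨ r n = -1) (j : ℕ) :
    ∃ x ∈ Set.Icc (0 : ℝ) 1, j * x + takagi r x ≤ -passageSum r j + (1 / 2) ^ n := by
  induction n generalizing r j with
  | zero =>
    refine ⟨0, by simp, ?_⟩
    rw [takagi_zero, pow_zero]
    linarith [passageSum_le_one hr j]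
  | succ n ih =>
    have hr' : ∀ n, r (n + 1) = 1 ∨ r (n + 1) = -1 := fun n => hr (n + 1)
    suffices ∃ y ∈ Set.Icc (0 : ℝ) 1, (j + r 0) * y + takagi (fun n => r (n + 1)) y
        ≤ -(2 * passageSum r j) + (1 / 2) ^ n by
      obtain ⟨y, hy, h⟩ := this
      refine ⟨y / 2, ⟨by linarith [hy.1], by linarith [hy.1, hy.2]⟩, ?_⟩
      rw [takagi_half hr hy, pow_succ]
      linarith
    rcases hr 0 with h0 | h0
    · obtain ⟨y, hy, h⟩ := ih hr' (j + 1)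
      refine ⟨y, hy, ?_⟩
      rw [passageSum_of_up h0, h0]
      push_cast at h
      linarith
    · cases j with
      | zero =>
        obtain ⟨y, hy, h⟩ := ih hr' 1
        refine ⟨1 - y, ⟨by linarith [hy.2], by linarith [hy.1]⟩, ?_⟩
        rw [takagi_one_sub, passageSum_zero_of_down hr h0, h0]
        push_cast at h ⊢
        linarith
      | succ j =>
        obtain ⟨y, hy, h⟩ := ih hr' j
        refine ⟨y, hy, ?_⟩
        rw [passageSum_succ_of_down h0, h0]
        push_cast
        linarith

/-- The minimum value of a signed Takagi function `f` over `[0,1]` is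
`m(f) = -∑_{k=1}^∞ (1/2)^{τ_{1-2k}}`. -/
theorem signed_takagi_min (r : ℕ → ℝ) (hr : ∀ n, r n = 1 ∨ r n = -1) :
    IsLeast (takagi r '' Set.Icc 0 1)
      (-∑' k : ℕ, halfPow (tau r (-(2 * (k : ℤ) + 1)))) := by
  have hsum : ∑' k : ℕ, halfPow (tau r (-(2 * (k : ℤ) + 1))) = passageSum r 0 := by
    simp [passageSum]
  have hlim : Filter.Tendsto (fun n : ℕ => (1 / 2 : ℝ) ^ n) Filter.atTop (nhds 0) :=
    tendsto_pow_atTop_nhds_zero_of_lt_one (by norm_num) (by norm_num)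
  have hlower : ∀ x ∈ Set.Icc (0 : ℝ) 1, -passageSum r 0 ≤ takagi r x := fun x hx => by
    have h := hlim.const_sub (-passageSum r 0)
    rw [sub_zero] at h
    exact le_of_tendsto' h fun n => by simpa using neg_passageSum_sub_le_takagi n hr 0 hx
  obtain ⟨x, hx, hmin⟩ := isCompact_Icc.exists_isMinOn (Set.nonempty_Icc.2 zero_le_one)
    (continuous_takagi hr).continuousOn
  have hupper : takagi r x ≤ -passageSum r 0 := by
    have h := hlim.const_add (-passageSum r 0)
    rw [add_zero] at h
    refine ge_of_tendsto' h fun n => ?_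
    obtain ⟨y, hy, hyn⟩ := exists_takagi_le n hr 0
    exact (hmin hy).trans (by simpa using hyn)
  rw [hsum]
  exact ⟨⟨x, hx, le_antisymm hupper (hlower x hx)⟩, by rintro _ ⟨y, hy, rfl⟩; exact hlower y hy⟩
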